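/- Assume E/F is biquadratic and that for every z ∈ E₀^× with tr_{E₀/F}(z) = 0 one has β δ₀ z⁻¹ ∉ N_{E/E₀}(E^×). Set δ(x,y) = δ₀ x σ(y) and n = −ν_Λ(β). Then: ν_E(δ(v₀,v₀)) = 1 − d; the integer n + d is odd; for every v ∈ V ∖ {0}, e(E₀/F)·ν_F(h(v, βv)) = ν_{E₀}(β δ(v,v)); and for every v ∈ V ∖ {0} and s ∈ ℤ, ν_F(h(v,βv)) = s if and only if v ∈ Λ(s + (n+d−1)/2) ∖ Λ(s + (n+d+1)/2). (Lemma 5.2.1.) -/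

import Mathlib

/-- Encoding of a nonarchimedean local field via a (normalized, surjective)
additive valuation `ν : K → ℤ` with junk value at `0`:  `ν` is additive on
products and ultrametric on nonzero elements, `ν(K^×) = ℤ`, the field is
complete (every `ν`-Cauchy sequence converges), and the residue field is
finite (finitely many residue classes of integers). -/
structure IsNALocalField {K : Type*} [Field K] (ν : K → ℤ) : Prop where
  map_mul : ∀ x y : K, x ≠ 0 → y ≠ 0 → ν (x * y) = ν x + ν y
  ultrametric : ∀ x y : K, x ≠ 0 → y ≠ 0 → x + y ≠ 0 → min (ν x) (ν y) ≤ ν (x + y)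
  surj : ∀ n : ℤ, ∃ x : K, x ≠ 0 ∧ ν x = n
  complete : ∀ a : ℕ → K,
    (∀ N : ℤ, ∃ M : ℕ, ∀ m ≥ M, ∀ n ≥ M, a m = a n ∨ N ≤ ν (a m - a n)) →
    ∃ L : K, ∀ N : ℤ, ∃ M : ℕ, ∀ m ≥ M, a m = L ∨ N ≤ ν (a m - L)
  finiteResidue : ∃ S : Finset K, ∀ x : K, (x = 0 ∨ 0 ≤ ν x) →
    ∃ y ∈ S, x = y ∨ 0 < ν (x - y)

/-- Odd residual characteristic: `2` is a unit of the valuation ring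
(equivalently, the characteristic of the residue field is odd). -/
def OddResidualChar {K : Type*} [Field K] (ν : K → ℤ) : Prop :=
  (2 : K) ≠ 0 ∧ ν (2 : K) = 0

/-- `E/F` is biquadratic: Galois with group `ℤ/2ℤ × ℤ/2ℤ`. -/
def IsBiquadratic (F E : Type*) [Field F] [Field E] [Algebra F E] : Prop :=
  IsGalois F E ∧ Nonempty ((E ≃ₐ[F] E) ≃* Multiplicative (ZMod 2 × ZMod 2))

/-- `x` has valuation at least `N`, where the valuation of `0` is read as `+∞`. -/
def ValGE {K : Type*} [Field K] (ν : K → ℤ) (N : ℤ) (x : K) : Prop :=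
  x = 0 ∨ N ≤ ν x

namespace IsNALocalField

section Basic

variable {K : Type*} [Field K] {ν : K → ℤ}

theorem val_one (hK : IsNALocalField ν) : ν 1 = 0 := by
  have := hK.map_mul 1 1 one_ne_zero one_ne_zero
  rw [mul_one] at this
  lia

theorem val_neg (hK : IsNALocalField ν) {x : K} (hx : x ≠ 0) : ν (-x) = ν x := by
  have h1 := hK.map_mul (-1) (-1) (by simp) (by simp)
  have h2 := hK.map_mul (-1) x (by simp) hx
  have h3 := hK.val_one
  simp only [neg_mul, one_mul, neg_neg] at h1 h2
  lia

theorem val_inv (hK : IsNALocalField ν) {x : K} (hx : x ≠ 0) : ν x⁻¹ = -ν x := by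
  have h1 := hK.map_mul x x⁻¹ hx (inv_ne_zero hx)
  have h3 := hK.val_one
  rw [mul_inv_cancel₀ hx] at h1
  lia

theorem val_pow (hK : IsNALocalField ν) {x : K} (hx : x ≠ 0) (k : ℕ) :
    ν (x ^ k) = k * ν x := by
  induction k with
  | zero => simp [hK.val_one]
  | succ k ih =>
    rw [pow_succ, hK.map_mul _ _ (pow_ne_zero k hx) hx, ih]
    push_cast
    ring

theorem valGE_add (hK : IsNALocalField ν) {N : ℤ} {x y : K} (hx : ValGE ν N x)
    (hy : ValGE ν N y) : ValGE ν N (x + y) := by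
  by_cases hx0 : x = 0
  · simpa [hx0] using hy
  by_cases hy0 : y = 0
  · simpa [hy0] using hx
  by_cases hxy : x + y = 0
  · exact Or.inl hxy
  have := hK.ultrametric x y hx0 hy0 hxy
  have h1 := hx.resolve_left hx0
  have h2 := hy.resolve_left hy0
  exact Or.inr (by lia)

theorem valGE_neg (hK : IsNALocalField ν) {N : ℤ} {x : K} (hx : ValGE ν N x) :
    ValGE ν N (-x) := by
  by_cases hx0 : x = 0
  · exact Or.inl (by simp [hx0])
  · exact Or.inr (by rw [hK.val_neg hx0]; exact hx.resolve_left hx0)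

theorem valGE_sub (hK : IsNALocalField ν) {N : ℤ} {x y : K} (hx : ValGE ν N x)
    (hy : ValGE ν N y) : ValGE ν N (x - y) := by
  rw [sub_eq_add_neg]
  exact hK.valGE_add hx (hK.valGE_neg hy)

theorem valGE_mul (hK : IsNALocalField ν) {M N : ℤ} {x y : K} (hx : ValGE ν M x)
    (hy : ValGE ν N y) : ValGE ν (M + N) (x * y) := by
  by_cases hx0 : x = 0
  · exact Or.inl (by simp [hx0])
  by_cases hy0 : y = 0
  · exact Or.inl (by simp [hy0])
  have h1 := hx.resolve_left hx0
  have h2 := hy.resolve_left hy0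
  exact Or.inr (by rw [hK.map_mul _ _ hx0 hy0]; lia)

theorem valGE_sum (hK : IsNALocalField ν) {N : ℤ} {ι : Type*} (s : Finset ι) (f : ι → K)
    (hf : ∀ i ∈ s, ValGE ν N (f i)) : ValGE ν N (∑ i ∈ s, f i) :=
  Finset.sum_induction f (ValGE ν N) (fun _ _ => hK.valGE_add) (Or.inl rfl) hf

end Basic

end IsNALocalField

theorem ValGE.mono {K : Type*} [Field K] {ν : K → ℤ} {M N : ℤ} {x : K} (hx : ValGE ν N x)
    (hMN : M ≤ N) : ValGE ν M x :=
  hx.imp id hMN.trans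

theorem eq_zero_of_forall_valGE {K : Type*} [Field K] {ν : K → ℤ} {x : K}
    (hx : ∀ N, ValGE ν N x) : x = 0 := by
  rcases hx (ν x + 1) with h | h
  · exact h
  · lia

namespace IsNALocalField

section Hensel

variable {K : Type*} [Field K] {ν : K → ℤ}

/-- A perturbation of strictly larger valuation changes neither nonvanishing nor valuation. -/
theorem val_add_eq (hK : IsNALocalField ν) {x u : K} (hx : x ≠ 0)
    (hu : ValGE ν (ν x + 1) u) : x + u ≠ 0 ∧ ν (x + u) = ν x := by
  by_cases hu0 : u = 0
  · simp [hu0, hx]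
  have h1 := hu.resolve_left hu0
  have hne : x + u ≠ 0 := by
    intro h0
    have : u = -x := by linear_combination h0
    rw [this, hK.val_neg hx] at h1
    lia
  refine ⟨hne, ?_⟩
  have h2 := hK.ultrametric x u hx hu0 hne
  have h3 := hK.ultrametric (x + u) (-u) hne (neg_ne_zero.2 hu0) (by simpa using hx)
  rw [hK.val_neg hu0, add_neg_cancel_right] at h3
  lia

theorem valGE_half (hK : IsNALocalField ν) (h2 : OddResidualChar ν) {N : ℤ} {x : K}
    (hx : ValGE ν N x) : ValGE ν N (x / 2) := by
  have h3 : ValGE ν 0 (2 : K)⁻¹ := Or.inr (by rw [hK.val_inv h2.1, h2.2]; simp)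
  simpa [div_eq_mul_inv] using hK.valGE_mul hx h3

/-- In odd residual characteristic every principal unit is the square of a principal unit. -/
theorem exists_sq_eq_one_add (hK : IsNALocalField ν) (h2 : OddResidualChar ν) {u : K}
    (hu : ValGE ν 1 u) : ∃ t, ValGE ν 1 t ∧ (1 + t) ^ 2 = 1 + u := by
  have h20 := h2.1
  let a : ℕ → K := fun k => Nat.rec 0 (fun _ t => (u - t ^ 2) / 2) k
  have ha : ∀ k, a (k + 1) = (u - a k ^ 2) / 2 := fun k => rfl
  have ha1 : ∀ k, ValGE ν 1 (a k) := by
    intro k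
    induction k with
    | zero => exact Or.inl rfl
    | succ k ih =>
      rw [ha]
      refine hK.valGE_half h2 (hK.valGE_sub hu ?_)
      rw [sq]
      exact (hK.valGE_mul ih ih).mono (by lia)
  have hstep : ∀ k : ℕ, ValGE ν (k + 1) (a (k + 1) - a k) := by
    intro k
    induction k with
    | zero => simpa using hK.valGE_sub (ha1 1) (ha1 0)
    | succ k ih =>
      have : a (k + 1 + 1) - a (k + 1) = -((a (k + 1) - a k) * ((a (k + 1) + a k) / 2)) := by
        rw [ha (k + 1)]
        nth_rewrite 2 [ha k]
        field_simp
        ring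
      rw [this]
      refine hK.valGE_neg ((hK.valGE_mul ih
        (hK.valGE_half h2 (hK.valGE_add (ha1 (k + 1)) (ha1 k)))).mono ?_)
      push_cast
      lia
  have hdiff : ∀ k m : ℕ, ValGE ν (k + 1) (a (k + m) - a k) := by
    intro k m
    induction m with
    | zero => exact Or.inl (by simp)
    | succ m ih =>
      have := hK.valGE_add ((hstep (k + m)).mono (M := (k : ℤ) + 1) (by push_cast; lia)) ih
      simpa [add_assoc] using this
  obtain ⟨L, hL⟩ := hK.complete a (by
    intro N
    refine ⟨N.toNat, fun m hm n hn => ?_⟩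
    obtain ⟨m', rfl⟩ := Nat.exists_eq_add_of_le hm
    obtain ⟨n', rfl⟩ := Nat.exists_eq_add_of_le hn
    have := hK.valGE_sub (hdiff N.toNat m') (hdiff N.toNat n')
    rw [sub_sub_sub_cancel_right] at this
    exact (this.mono (by lia)).imp sub_eq_zero.1 id)
  have hlim : ∀ N : ℤ, ∃ M : ℕ, ∀ m ≥ M, ValGE ν N (a m - L) := fun N =>
    (hL N).imp fun M hM m hm => (hM m hm).imp sub_eq_zero.2 id
  have hL1 : ValGE ν 1 L := by
    obtain ⟨M, hM⟩ := hlim 1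
    simpa using hK.valGE_sub (ha1 M) (hM M le_rfl)
  refine ⟨L, hL1, ?_⟩
  have hfix : (u - L ^ 2) / 2 - L = 0 := by
    refine eq_zero_of_forall_valGE (ν := ν) fun N => ?_
    obtain ⟨M, hM⟩ := hlim N
    have e : (u - L ^ 2) / 2 - L =
        (a M - L) * ((a M + L) / 2) + (a (M + 1) - L) := by
      rw [ha M]
      field_simp
      ring
    rw [e]
    exact hK.valGE_add ((hK.valGE_mul (hM M le_rfl)
      (hK.valGE_half h2 (hK.valGE_add (ha1 M) hL1))).mono (by lia)) (hM (M + 1) (by lia))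
  field_simp at hfix
  linear_combination -hfix

/-- Ring automorphisms send elements of positive valuation to integral elements. -/
theorem valGE_zero_map (hK : IsNALocalField ν) (h2 : OddResidualChar ν) (τ : K →+* K) {u : K}
    (hu : ValGE ν 1 u) : ValGE ν 0 (τ u) := by
  have hone : ∀ {w : K}, ValGE ν 1 w → 1 + w ≠ 0 := fun hw =>
    (hK.val_add_eq one_ne_zero (by rwa [hK.val_one, zero_add])).1
  have hdvd : ∀ (k : ℕ) (w : K), ValGE ν 1 w → (2 : ℤ) ^ k ∣ ν (τ (1 + w)) := by
    intro k
    induction k with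
    | zero => simp
    | succ k ih =>
      intro w hw
      obtain ⟨t, ht, htw⟩ := hK.exists_sq_eq_one_add h2 hw
      rw [← htw, map_pow, hK.val_pow ((map_ne_zero τ).2 (hone ht)), pow_succ, mul_comm]
      exact mul_dvd_mul (by simp) (ih t ht)
  by_contra hcon
  obtain ⟨h0, hneg⟩ := not_or.1 hcon
  have hval : ν (τ (1 + u)) = ν (τ u) := by
    rw [map_add, map_one, add_comm]
    exact (hK.val_add_eq h0 (Or.inr (by rw [hK.val_one]; lia))).2
  have h3 := hdvd (ν (τ u)).natAbs u hu
  rw [hval] at h3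
  have h4 := Nat.le_of_dvd (by lia) (Int.natAbs_dvd_natAbs.2 h3)
  rw [Int.natAbs_pow] at h4
  exact absurd (Nat.lt_two_pow_self (n := (ν (τ u)).natAbs)) (by simpa using h4)

end Hensel

section Residue

variable {K : Type*} [Field K] {ν : K → ℤ}

/-- The valuation ring of a nonarchimedean local field. -/
def integers (hK : IsNALocalField ν) : ValuationSubring K where
  carrier := {x | ValGE ν 0 x}
  mul_mem' hx hy := by simpa using hK.valGE_mul hx hy
  one_mem' := Or.inr hK.val_one.ge
  add_mem' := hK.valGE_add
  zero_mem' := Or.inl rfl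
  neg_mem' := hK.valGE_neg
  mem_or_inv_mem' x := by
    by_cases hx : x = 0
    · exact Or.inl (Or.inl hx)
    · rcases le_total 0 (ν x) with h | h
      · exact Or.inl (Or.inr h)
      · exact Or.inr (Or.inr (by rw [hK.val_inv hx]; lia))

theorem residue_eq_zero_iff (hK : IsNALocalField ν) (x : hK.integers) :
    IsLocalRing.residue hK.integers x = 0 ↔ ValGE ν 1 (x : K) := by
  rw [IsLocalRing.residue_eq_zero_iff, IsLocalRing.mem_maximalIdeal, mem_nonunits_iff]
  have hx : ValGE ν 0 (x : K) := x.2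
  constructor
  · intro hu
    by_contra hcon
    obtain ⟨h0, h1⟩ := not_or.1 hcon
    refine hu (IsUnit.of_mul_eq_one ⟨(x : K)⁻¹, Or.inr ?_⟩ (Subtype.ext (mul_inv_cancel₀ h0)))
    have := hx.resolve_left h0
    rw [hK.val_inv h0]
    lia
  · intro h1 hu
    obtain ⟨b, hb1⟩ := hu.exists_right_inv
    have hxb : (x : K) * b = 1 := congrArg Subtype.val hb1
    have hb : ValGE ν 0 (b : K) := b.2
    have := hK.valGE_mul h1 hb
    rw [hxb] at this
    rcases this with h | h
    · exact one_ne_zero h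
    · rw [hK.val_one] at h
      lia

theorem finite_residueField (hK : IsNALocalField ν) :
    Finite (IsLocalRing.ResidueField hK.integers) := by
  classical
  obtain ⟨S, hS⟩ := hK.finiteResidue
  let f : S → IsLocalRing.ResidueField hK.integers := fun s =>
    if hs : (s : K) ∈ hK.integers then IsLocalRing.residue hK.integers ⟨s, hs⟩ else 0
  refine Finite.of_surjective f fun y => ?_
  obtain ⟨x, rfl⟩ := IsLocalRing.residue_surjective y
  obtain ⟨s, hsS, hs⟩ := hS x x.2
  have hs1 : ValGE ν 1 ((x : K) - s) := hs.imp sub_eq_zero.2 id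
  have hsO : s ∈ hK.integers := by
    have : ValGE ν 0 ((x : K) - (x - s)) := hK.valGE_sub x.2 (hs1.mono (by lia))
    rwa [sub_sub_cancel] at this
  refine ⟨⟨s, hsS⟩, ?_⟩
  simp only [f, dif_pos hsO]
  rw [eq_comm, ← sub_eq_zero, ← map_sub]
  exact (hK.residue_eq_zero_iff _).2 hs1

/-- A unit whose residue is a square is a square. -/
theorem isSquare_of_isSquare_residue (hK : IsNALocalField ν) (h2 : OddResidualChar ν)
    (a : hK.integers) (ha0 : (a : K) ≠ 0) (ha : ν (a : K) = 0)
    (hsq : IsSquare (IsLocalRing.residue hK.integers a)) : IsSquare (a : K) := by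
  obtain ⟨r, hr⟩ := hsq
  obtain ⟨c, rfl⟩ := IsLocalRing.residue_surjective r
  rw [← _root_.map_mul, ← sub_eq_zero, ← map_sub, hK.residue_eq_zero_iff] at hr
  have hu : ValGE ν 1 (((c : K) * c - a) / a) := by
    have h1 : ValGE ν 0 (a : K)⁻¹ := Or.inr (by rw [hK.val_inv ha0, ha]; simp)
    have := hK.valGE_mul (hK.valGE_neg hr) h1
    simpa [div_eq_mul_inv] using this
  obtain ⟨t, ht, hts⟩ := hK.exists_sq_eq_one_add h2 hu
  have ht0 : 1 + t ≠ 0 := (hK.val_add_eq one_ne_zero (by rwa [hK.val_one, zero_add])).1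
  refine ⟨c / (1 + t), ?_⟩
  field_simp at hts ⊢
  linear_combination hts

/-- Among two units and their product at least one is a square. -/
theorem isSquare_or_isSquare_or_isSquare_mul (hK : IsNALocalField ν)
    (h2 : OddResidualChar ν) {a b : K} (ha0 : a ≠ 0) (hb0 : b ≠ 0) (ha : ν a = 0)
    (hb : ν b = 0) : IsSquare a ∨ IsSquare b ∨ IsSquare (a * b) := by
  classical
  have := hK.finite_residueField
  have := Fintype.ofFinite (IsLocalRing.ResidueField hK.integers)
  let a' : hK.integers := ⟨a, Or.inr ha.ge⟩
  let b' : hK.integers := ⟨b, Or.inr hb.ge⟩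
  by_cases hsa : IsSquare (IsLocalRing.residue hK.integers a')
  · exact Or.inl (hK.isSquare_of_isSquare_residue h2 a' ha0 ha hsa)
  by_cases hsb : IsSquare (IsLocalRing.residue hK.integers b')
  · exact Or.inr (Or.inl (hK.isSquare_of_isSquare_residue h2 b' hb0 hb hsb))
  refine Or.inr (Or.inr (hK.isSquare_of_isSquare_residue h2 (a' * b') (mul_ne_zero ha0 hb0)
    ((hK.map_mul a b ha0 hb0).trans (by lia)) ?_))
  rw [_root_.map_mul]
  have hne : IsLocalRing.residue hK.integers a' * IsLocalRing.residue hK.integers b' ≠ 0 :=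
    mul_ne_zero (fun h => hsa (h ▸ IsSquare.zero)) (fun h => hsb (h ▸ IsSquare.zero))
  rw [← quadraticChar_one_iff_isSquare hne, _root_.map_mul,
    quadraticChar_neg_one_iff_not_isSquare.2 hsa, quadraticChar_neg_one_iff_not_isSquare.2 hsb]
  norm_num

end Residue

section Extension

variable {F E : Type*} [Field F] [Field E] [Algebra F E] {νF : F → ℤ} {νE : E → ℤ} {e : ℤ}

theorem oddResidualChar_of_extension (hodd : OddResidualChar νF)
    (hcompat : ∀ t : F, t ≠ 0 → νE (algebraMap F E t) = e * νF t) : OddResidualChar νE := by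
  have h := hcompat 2 hodd.1
  rw [hodd.2, mul_zero, map_ofNat] at h
  refine ⟨?_, h⟩
  have := (map_ne_zero (algebraMap F E)).2 hodd.1
  rwa [map_ofNat] at this

theorem val_le_val_algEquiv (hF : IsNALocalField νF) (hE : IsNALocalField νE)
    (hodd : OddResidualChar νF) (he : 0 < e)
    (hcompat : ∀ t : F, t ≠ 0 → νE (algebraMap F E t) = e * νF t) (τ : E ≃ₐ[F] E) {x : E}
    (hx : x ≠ 0) : νE x ≤ νE (τ x) := by
  have h2 := oddResidualChar_of_extension hodd hcompat
  have hF0 : ∀ {t : F}, t ≠ 0 → algebraMap F E t ≠ 0 := fun ht => (map_ne_zero _).2 ht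
  have hτ0 : ∀ {y : E}, y ≠ 0 → τ y ≠ 0 := fun hy => by simpa using hy
  have hint : ∀ y : E, y ≠ 0 → 0 ≤ νE y → 0 ≤ νE (τ y) := by
    intro y hy hy0
    obtain ⟨ϖ, hϖ0, hϖ⟩ := hF.surj 1
    obtain ⟨k, hk⟩ : ∃ k : ℕ, e + 1 = k := Int.eq_ofNat_of_zero_le (by lia)
    have hu : ValGE νE 1 (algebraMap F E ϖ * y ^ k) := Or.inr (by
      rw [hE.map_mul _ _ (hF0 hϖ0) (pow_ne_zero k hy), hcompat ϖ hϖ0, hϖ, hE.val_pow hy]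
      have : 0 ≤ (k : ℤ) * νE y := by positivity
      lia)
    have h := hE.valGE_zero_map h2 (τ : E →+* E) hu
    have h' : ValGE νE 0 (algebraMap F E ϖ * τ y ^ k) := by simpa using h
    have h3 := h'.resolve_left (mul_ne_zero (hF0 hϖ0) (pow_ne_zero k (hτ0 hy)))
    rw [hE.map_mul _ _ (hF0 hϖ0) (pow_ne_zero k (hτ0 hy)), hcompat ϖ hϖ0, hϖ,
      hE.val_pow (hτ0 hy), ← hk] at h3
    by_contra hcon
    nlinarith
  obtain ⟨c, hc0, hc⟩ := hF.surj (-νE x)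
  obtain ⟨k, hk⟩ : ∃ k : ℕ, e = k := Int.eq_ofNat_of_zero_le he.le
  have h := hint (algebraMap F E c * x ^ k) (mul_ne_zero (hF0 hc0) (pow_ne_zero k hx)) (by
    rw [hE.map_mul _ _ (hF0 hc0) (pow_ne_zero k hx), hcompat c hc0, hc, hE.val_pow hx,
      ← hk]
    lia)
  rw [_root_.map_mul, map_pow, AlgEquiv.commutes,
    hE.map_mul _ _ (hF0 hc0) (pow_ne_zero k (hτ0 hx)), hcompat c hc0, hc,
    hE.val_pow (hτ0 hx), ← hk] at h
  by_contra hcon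
  nlinarith

/-- The valuation of a local field is invariant under automorphisms over a local subfield. -/
theorem val_algEquiv (hF : IsNALocalField νF) (hE : IsNALocalField νE)
    (hodd : OddResidualChar νF) (he : 0 < e)
    (hcompat : ∀ t : F, t ≠ 0 → νE (algebraMap F E t) = e * νF t) (τ : E ≃ₐ[F] E) {x : E}
    (hx : x ≠ 0) : νE (τ x) = νE x := by
  refine le_antisymm ?_ (hF.val_le_val_algEquiv hE hodd he hcompat τ hx)
  have h := hF.val_le_val_algEquiv hE hodd he hcompat τ.symm (x := τ x) (by simpa using hx)
  rwa [AlgEquiv.symm_apply_apply] at h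

theorem valGE_algEquiv (hF : IsNALocalField νF) (hE : IsNALocalField νE)
    (hodd : OddResidualChar νF) (he : 0 < e)
    (hcompat : ∀ t : F, t ≠ 0 → νE (algebraMap F E t) = e * νF t) (τ : E ≃ₐ[F] E) {N : ℤ}
    {x : E} (hx : ValGE νE N x) : ValGE νE N (τ x) := by
  by_cases h0 : x = 0
  · exact Or.inl (by simp [h0])
  · exact Or.inr (by
      rw [hF.val_algEquiv hE hodd he hcompat τ h0]
      exact hx.resolve_left h0)

theorem valGE_trace [FiniteDimensional F E] [IsGalois F E] (hF : IsNALocalField νF)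
    (hE : IsNALocalField νE) (hodd : OddResidualChar νF) (he : 0 < e)
    (hcompat : ∀ t : F, t ≠ 0 → νE (algebraMap F E t) = e * νF t) {N : ℤ} {x : E}
    (hx : ValGE νE N x) : ValGE νE N (algebraMap F E (Algebra.trace F E x)) := by
  rw [trace_eq_sum_automorphisms]
  exact hE.valGE_sum _ _ fun τ _ => hF.valGE_algEquiv hE hodd he hcompat τ hx

/-- If the trace of a `σ`-fixed element `x` has larger valuation than `x`, then `x` is
a product of a trace zero `σ`-fixed element and the square of a `σ`-fixed element. -/
theorem exists_trace_zero_mul_sq [FiniteDimensional F E] (hF : IsNALocalField νF)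
    (hE : IsNALocalField νE) (hodd : OddResidualChar νF)
    (hdim : Module.finrank F E = 4) (he : 0 < e)
    (hcompat : ∀ t : F, t ≠ 0 → νE (algebraMap F E t) = e * νF t) (σ : E ≃ₐ[F] E) {x : E}
    (hx : x ≠ 0) (hσx : σ x = x)
    (htr : ValGE νE (νE x + 1) (algebraMap F E (Algebra.trace F E x))) :
    ∃ z y : E, z ≠ 0 ∧ y ≠ 0 ∧ σ z = z ∧ σ y = y ∧ Algebra.trace F E z = 0 ∧
      x = z * y ^ 2 := by
  have h2 := oddResidualChar_of_extension hodd hcompat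
  have h20 := hodd.1
  have h20E := h2.1
  set T := Algebra.trace F E x with hT
  have hT4 : algebraMap F E (T / 2 / 2) = algebraMap F E T / 2 / 2 := by
    rw [map_div₀, map_div₀, map_ofNat]
  have hge : ValGE νE (νE x + 1) (algebraMap F E (T / 2 / 2)) := by
    rw [hT4]
    exact hE.valGE_half h2 (hE.valGE_half h2 htr)
  obtain ⟨hz0, hzν⟩ := hE.val_add_eq hx (hE.valGE_neg hge)
  rw [← sub_eq_add_neg] at hz0 hzν
  set w := algebraMap F E (T / 2 / 2) with hw
  have hσz : σ (x - w) = x - w := by rw [map_sub, hσx, hw, AlgEquiv.commutes]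
  have hu : ValGE νE 1 (w / (x - w)) := by
    have h1 : ValGE νE (-νE x) (x - w)⁻¹ := Or.inr (by rw [hE.val_inv hz0, hzν])
    rw [div_eq_mul_inv]
    exact (hE.valGE_mul hge h1).mono (by lia)
  obtain ⟨t, ht, hts⟩ := hE.exists_sq_eq_one_add h2 hu
  have ht0 : 1 + t ≠ 0 := (hE.val_add_eq one_ne_zero (by rwa [hE.val_one, zero_add])).1
  refine ⟨x - w, 1 + t, hz0, ht0, hσz, ?_, ?_, ?_⟩
  · have hsq : (σ (1 + t)) ^ 2 = (1 + t) ^ 2 := by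
      rw [← map_pow, hts, map_add, map_div₀, hσz, map_one, hw, AlgEquiv.commutes]
    rcases sq_eq_sq_iff_eq_or_eq_neg.1 hsq with h | h
    · exact h
    · exfalso
      have h3 : -(t + σ t) = 2 := by
        rw [map_add, map_one] at h
        linear_combination -h
      have h4 := hE.valGE_neg (hE.valGE_add ht (hF.valGE_algEquiv hE hodd he hcompat σ ht))
      rw [h3] at h4
      have h5 := h4.resolve_left h20E
      rw [h2.2] at h5
      lia
  · rw [map_sub, hw, Algebra.trace_algebraMap, hdim, ← hT]
    simp only [nsmul_eq_mul]
    push_cast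
    field_simp
    ring
  · rw [hts]
    field_simp
    ring

end Extension

end IsNALocalField

section Biquadratic

variable {F E : Type*} [Field F] [Field E] [Algebra F E]

theorem IsBiquadratic.mul_self (hbiq : IsBiquadratic F E) (g : E ≃ₐ[F] E) : g * g = 1 := by
  obtain ⟨φ⟩ := hbiq.2
  have key : ∀ a : Multiplicative (ZMod 2 × ZMod 2), a * a = 1 := by decide
  exact φ.injective (by rw [map_mul, map_one]; exact key _)

theorem IsBiquadratic.mul_comm (hbiq : IsBiquadratic F E) (g k : E ≃ₐ[F] E) :
    g * k = k * g := by
  obtain ⟨φ⟩ := hbiq.2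
  exact φ.injective (by rw [map_mul, map_mul, _root_.mul_comm])

theorem IsBiquadratic.exists_generator (hbiq : IsBiquadratic F E) {g : E ≃ₐ[F] E}
    (hg : g ≠ 1) : ∃ k : E ≃ₐ[F] E, k ≠ 1 ∧ k ≠ g ∧
      ∀ m : E ≃ₐ[F] E, m = 1 ∨ m = g ∨ m = k ∨ m = g * k := by
  obtain ⟨φ⟩ := hbiq.2
  have key : ∀ a : Multiplicative (ZMod 2 × ZMod 2), a ≠ 1 →
      ∃ b, b ≠ 1 ∧ b ≠ a ∧ ∀ c, c = 1 ∨ c = a ∨ c = b ∨ c = a * b := by decide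
  obtain ⟨b, hb1, hba, hb⟩ := key (φ g) (by simpa using hg)
  refine ⟨φ.symm b, by simpa using hb1, fun h => hba (by simp [← h]), fun m => ?_⟩
  rcases hb (φ m) with h | h | h | h
  · exact Or.inl (φ.injective (by simpa using h))
  · exact Or.inr (Or.inl (φ.injective h))
  · exact Or.inr (Or.inr (Or.inl (φ.injective (by simpa using h))))
  · exact Or.inr (Or.inr (Or.inr (φ.injective (by simpa using h))))

/-- Each nontrivial automorphism negates some simultaneous eigenvector of the Galois group. -/
theorem IsBiquadratic.exists_eigenvector (hbiq : IsBiquadratic F E)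
    {g : E ≃ₐ[F] E} (hg : g ≠ 1) :
    ∃ α : E, α ≠ 0 ∧ g α = -α ∧ ∀ m : E ≃ₐ[F] E, m α = α ∨ m α = -α := by
  obtain ⟨k, -, -, hk⟩ := hbiq.exists_generator hg
  have hgg : ∀ x, g (g x) = x := fun x => DFunLike.congr_fun (hbiq.mul_self g) x
  have hkk : ∀ x, k (k x) = x := fun x => DFunLike.congr_fun (hbiq.mul_self k) x
  have hgk : ∀ x, g (k x) = k (g x) := fun x => DFunLike.congr_fun (hbiq.mul_comm g k) x
  obtain ⟨y, hy⟩ : ∃ y, g y ≠ y := by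
    by_contra! hcon
    exact hg (AlgEquiv.ext hcon)
  have hw0 : y - g y ≠ 0 := fun h => hy (sub_eq_zero.1 h).symm
  have hgw : g (y - g y) = -(y - g y) := by rw [map_sub, hgg, neg_sub]
  generalize y - g y = w at hw0 hgw
  have hgkw : g (k w) = -k w := by rw [hgk, hgw, map_neg]
  by_cases h0 : w + k w = 0
  · refine ⟨w, hw0, hgw, fun m => ?_⟩
    have hkw : k w = -w := by linear_combination h0
    rcases hk m with rfl | rfl | rfl | rfl
    · exact Or.inl rfl
    · exact Or.inr hgw
    · exact Or.inr hkw
    · exact Or.inl (by rw [AlgEquiv.mul_apply, hgkw, hkw, neg_neg])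
  · have hga : g (w + k w) = -(w + k w) := by rw [map_add, hgw, hgkw]; ring
    have hka : k (w + k w) = w + k w := by rw [map_add, hkk]; ring
    refine ⟨w + k w, h0, hga, fun m => ?_⟩
    rcases hk m with rfl | rfl | rfl | rfl
    · exact Or.inl rfl
    · exact Or.inr hga
    · exact Or.inl hka
    · exact Or.inr (by rw [AlgEquiv.mul_apply, hka, hga])

/-- A biquadratic extension in odd residual characteristic is ramified. -/
theorem IsBiquadratic.ramificationIndex_ne_one [FiniteDimensional F E]
    (hbiq : IsBiquadratic F E) {νF : F → ℤ}
    {νE : E → ℤ} (hF : IsNALocalField νF) (hE : IsNALocalField νE)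
    (hodd : OddResidualChar νF) {σ : E ≃ₐ[F] E} (hσ : σ ≠ 1)
    (hcompat : ∀ t : F, t ≠ 0 → νE (algebraMap F E t) = νF t) : False := by
  have := hbiq.1
  have h2 : (2 : E) ≠ 0 := (IsNALocalField.oddResidualChar_of_extension (e := 1) hodd
    (by simpa using hcompat)).1
  have hF0 : ∀ {t : F}, t ≠ 0 → algebraMap F E t ≠ 0 := fun ht => (map_ne_zero _).2 ht
  have hunit : ∀ {g : E ≃ₐ[F] E}, g ≠ 1 → ∃ (α : E) (a : F), α ≠ 0 ∧ a ≠ 0 ∧ νF a = 0 ∧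
      α ^ 2 = algebraMap F E a ∧ g α = -α ∧ ∀ m : E ≃ₐ[F] E, m α = α ∨ m α = -α := by
    intro g hg
    obtain ⟨α, hα0, hgα, hα⟩ := hbiq.exists_eigenvector hg
    obtain ⟨c, hc0, hc⟩ := hF.surj (-νE α)
    have hcα0 := mul_ne_zero (hF0 hc0) hα0
    have hcα : ∀ m : E ≃ₐ[F] E, m (algebraMap F E c * α) = algebraMap F E c * α ∨
        m (algebraMap F E c * α) = -(algebraMap F E c * α) := fun m => by
      rw [map_mul, AlgEquiv.commutes]
      rcases hα m with h | h <;> simp [h]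
    obtain ⟨a, ha⟩ := (IsGalois.mem_range_algebraMap_iff_fixed (F := F)
      ((algebraMap F E c * α) ^ 2)).2 fun m => by
        rw [map_pow]
        rcases hcα m with h | h <;> rw [h]
        ring
    have ha0 : a ≠ 0 := by
      rintro rfl
      rw [map_zero] at ha
      exact pow_ne_zero 2 hcα0 ha.symm
    refine ⟨algebraMap F E c * α, a, hcα0, ha0, ?_, ha.symm, ?_, hcα⟩
    · rw [← hcompat a ha0, ha, hE.val_pow hcα0, hE.map_mul _ _ (hF0 hc0) hα0, hcompat c hc0, hc]
      ring
    · rw [map_mul, AlgEquiv.commutes, hgα, mul_neg]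
  have hneg : ∀ {x : E}, x ≠ 0 → x ≠ -x := fun {x} hx h => by
    have : 2 * x = 0 := by linear_combination h
    exact (mul_ne_zero h2 hx) this
  have hfix : ∀ (x : E) (a : F), x ^ 2 = algebraMap F E a → IsSquare a →
      ∀ m : E ≃ₐ[F] E, m x = x := by
    rintro x _ hx ⟨c, rfl⟩ m
    rw [map_mul, ← sq] at hx
    rcases sq_eq_sq_iff_eq_or_eq_neg.1 hx with rfl | rfl <;> simp
  have hsame : ∀ {g k : E ≃ₐ[F] E} {α γ : E} {a b : F}, α ≠ 0 → γ ≠ 0 → a ≠ 0 → b ≠ 0 →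
      νF a = 0 → νF b = 0 → α ^ 2 = algebraMap F E a → γ ^ 2 = algebraMap F E b →
      g α = -α → k γ = -γ → k α = -α := by
    intro g k α γ a b hα0 hγ0 ha0 hb0 ha hb hαa hγb hgα hkγ
    rcases hF.isSquare_or_isSquare_or_isSquare_mul hodd ha0 hb0 ha hb with h | h | h
    · exact absurd ((hfix α a hαa h g).symm.trans hgα) (hneg hα0)
    · exact absurd ((hfix γ b hγb h k).symm.trans hkγ) (hneg hγ0)
    · have h1 := hfix (α * γ) (a * b) (by rw [mul_pow, hαa, hγb, map_mul]) h k
      rw [map_mul, hkγ] at h1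
      exact mul_right_cancel₀ hγ0 (by linear_combination -h1)
  obtain ⟨k, hk1, hkσ, -⟩ := hbiq.exists_generator hσ
  have hσk : σ * k ≠ 1 := fun h => hkσ (mul_left_cancel (h.trans (hbiq.mul_self σ).symm))
  obtain ⟨α, a, hα0, ha0, ha, hαa, hσα, -⟩ := hunit hσ
  obtain ⟨γ, b, hγ0, hb0, hb, hγb, hkγ, -⟩ := hunit hk1
  obtain ⟨ε, c, hε0, hc0, hc, hεc, hkε, -⟩ := hunit hσk
  have h1 := hsame hα0 hγ0 ha0 hb0 ha hb hαa hγb hσα hkγ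
  have h3 := hsame hα0 hε0 ha0 hc0 ha hc hαa hεc hσα hkε
  rw [AlgEquiv.mul_apply, h1, map_neg, hσα, neg_neg] at h3
  exact hneg hα0 h3

end Biquadratic

/-- Lemma 5.2.1.
Setup as in Statement 16 (biquadratic `E = F[β]`, coset condition,
`Λ(i) = 𝔭_E^i v₀` self-dual with invariant `d`), with `δ(x,y) = δ₀·x·σ(y)`
and `n = −ν_Λ(β) = −ν_E(β)`.  Here `ν₀` denotes the normalized valuation of
`E₀` (the fixed field of `σ`), `e₀ = e(E₀/F)` and `e' = e(E/E₀)`, so that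
`ν_E = e'·ν₀` on `E₀^×` and `e(E/F) = e'·e₀`.  Conclusions:
`ν_E(δ(v₀,v₀)) = 1 − d`; `n + d` is odd; for `v ≠ 0`, `h(v,βv) ≠ 0` and
`e(E₀/F)·ν_F(h(v,βv)) = ν_{E₀}(β·δ(v,v))`; and for `v ≠ 0` and `s ∈ ℤ`,
`ν_F(h(v,βv)) = s` iff `v ∈ Λ(s+(n+d−1)/2) ∖ Λ(s+(n+d+1)/2)`. -/
theorem valuation_lemma_biquadratic
    {F E : Type*} [Field F] [Field E] [Algebra F E] [FiniteDimensional F E]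
    (νF : F → ℤ) (νE : E → ℤ)
    (hF : IsNALocalField νF) (hE : IsNALocalField νE)
    (hodd : OddResidualChar νF)
    (hdim : Module.finrank F E = 4)
    (σ : E ≃ₐ[F] E) (hσ2 : ∀ x : E, σ (σ x) = x)
    (hσne : σ ≠ (AlgEquiv.refl : E ≃ₐ[F] E))
    (eEF e₀ e' : ℤ) (he₀ : 0 < e₀) (he' : 0 < e') (hee : eEF = e' * e₀)
    (hcompat : ∀ t : F, t ≠ 0 → νE (algebraMap F E t) = eEF * νF t)
    (ν₀ : E → ℤ)
    (hν₀ : ∀ x : E, x ≠ 0 → σ x = x → νE x = e' * ν₀ x)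
    (hν₀surj : ∀ m : ℤ, ∃ x : E, x ≠ 0 ∧ σ x = x ∧ ν₀ x = m)
    (β : E) (hβskew : σ β = -β) (hβgen : Algebra.adjoin F {β} = ⊤)
    (δ₀ : E) (hδ₀ : δ₀ ≠ 0) (hδ₀skew : σ δ₀ = -δ₀)
    (hbiq : IsBiquadratic F E)
    (hcoset : ∀ z : E, z ≠ 0 → σ z = z → Algebra.trace F E z = 0 →
      ¬∃ w : E, w ≠ 0 ∧ β * δ₀ * z⁻¹ = w * σ w)
    (h : E → E → F) (hh : ∀ x y : E, h x y = Algebra.trace F E (δ₀ * x * σ y))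
    (v₀ : E) (hv₀ : v₀ ≠ 0)
    (Λ : ℤ → Set E) (hΛ : ∀ i : ℤ, Λ i = {x : E | x = 0 ∨ i + νE v₀ ≤ νE x})
    (d : ℤ) (hd : d = 0 ∨ d = 1)
    (hdual : ∀ i : ℤ,
      {v : E | ∀ w ∈ Λ i, h v w = 0 ∨ 1 ≤ νF (h v w)} = Λ (d - i))
    (n : ℤ) (hn : n = -νE β) :
    νE (δ₀ * v₀ * σ v₀) = 1 - d ∧
    Odd (n + d) ∧
    (∀ v : E, v ≠ 0 →
      h v (β * v) ≠ 0 ∧ e₀ * νF (h v (β * v)) = ν₀ (β * (δ₀ * v * σ v))) ∧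
    (∀ v : E, v ≠ 0 → ∀ s : ℤ,
      νF (h v (β * v)) = s ↔
        (v ∈ Λ (s + (n + d - 1) / 2) ∧ v ∉ Λ (s + (n + d + 1) / 2))) := by
  have hGal := hbiq.1
  have he : 0 < eEF := hee ▸ mul_pos he' he₀
  have hσ0 : ∀ {x : E}, x ≠ 0 → σ x ≠ 0 := fun hx => by simpa using hx
  have hσν : ∀ {x : E}, x ≠ 0 → νE (σ x) = νE x := fun hx =>
    hF.val_algEquiv hE hodd he hcompat σ hx
  have hβ0 : β ≠ 0 := by
    rintro rfl
    refine hσne (AlgEquiv.ext fun x => ?_)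
    have hx : x ∈ Algebra.adjoin F {(0 : E)} := hβgen ▸ Algebra.mem_top
    rw [Algebra.adjoin_singleton_zero] at hx
    obtain ⟨c, rfl⟩ := Algebra.mem_bot.1 hx
    simp
  have hνδ : ∀ {v : E}, v ≠ 0 → νE (δ₀ * v * σ v) = νE δ₀ + 2 * νE v := fun {v} hv => by
    rw [hE.map_mul _ _ (mul_ne_zero hδ₀ hv) (hσ0 hv), hE.map_mul _ _ hδ₀ hv, hσν hv]
    ring
  have hδne : ∀ {v : E}, v ≠ 0 → δ₀ * v * σ v ≠ 0 := fun hv =>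
    mul_ne_zero (mul_ne_zero hδ₀ hv) (hσ0 hv)
  have hx0 : ∀ {v : E}, v ≠ 0 → β * (δ₀ * v * σ v) ≠ 0 := fun hv => mul_ne_zero hβ0 (hδne hv)
  have hσx : ∀ v : E, σ (β * (δ₀ * v * σ v)) = β * (δ₀ * v * σ v) := fun v => by
    simp only [map_mul, hβskew, hδ₀skew, hσ2]
    ring
  have hhv : ∀ v : E, Algebra.trace F E (β * (δ₀ * v * σ v)) = -h v (β * v) := fun v => by
    rw [hh, ← map_neg, map_mul σ, hβskew]
    congr 1
    ring
  have htrace : ∀ v : E, v ≠ 0 → h v (β * v) ≠ 0 ∧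
      eEF * νF (h v (β * v)) = νE (β * (δ₀ * v * σ v)) := by
    intro v hv
    have hge := hF.valGE_trace hE hodd he hcompat
      (N := νE (β * (δ₀ * v * σ v))) (Or.inr le_rfl)
    have hnot : ¬ValGE νE (νE (β * (δ₀ * v * σ v)) + 1)
        (algebraMap F E (Algebra.trace F E (β * (δ₀ * v * σ v)))) := by
      intro hlt
      obtain ⟨z, y, hz0, hy0, hσz, hσy, hz, hzy⟩ :=
        hF.exists_trace_zero_mul_sq hE hodd hdim he hcompat σ (hx0 hv) (hσx v) hlt
      refine hcoset z hz0 hσz hz ⟨y / v, div_ne_zero hy0 hv, ?_⟩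
      have := hσ0 hv
      rw [map_div₀, hσy]
      field_simp
      linear_combination hzy
    rw [hhv, map_neg] at hge hnot
    have hne : h v (β * v) ≠ 0 := fun h0 => hnot (Or.inl (by simp [h0]))
    have hne' : algebraMap F E (h v (β * v)) ≠ 0 := (map_ne_zero _).2 hne
    refine ⟨hne, ?_⟩
    have h1 := hge.resolve_left (neg_ne_zero.2 hne')
    have h3 := (not_or.1 hnot).2
    rw [hE.val_neg hne'] at h1 h3
    rw [← hcompat _ hne]
    lia
  have hδv₀ : νE (δ₀ * v₀ * σ v₀) = 1 - d := by
    rw [hνδ hv₀]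
    have hdual0 := hdual 0
    rw [sub_zero, hΛ d, hΛ 0] at hdual0
    apply le_antisymm
    · obtain ⟨v, hv0, hv⟩ := hE.surj (1 - νE δ₀ - νE v₀)
      have hmem : v ∈ {x : E | x = 0 ∨ d + νE v₀ ≤ νE x} := by
        rw [← hdual0]
        intro w hw
        by_cases hhw : h v w = 0
        · exact Or.inl hhw
        have hw0 : w ≠ 0 := by
          rintro rfl
          exact hhw (by simp [hh])
        have hwν := hw.resolve_left hw0
        have hge := hF.valGE_trace hE hodd he hcompat (N := 1) (x := δ₀ * v * σ w) (Or.inr (by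
          rw [hE.map_mul _ _ (mul_ne_zero hδ₀ hv0) (hσ0 hw0), hE.map_mul _ _ hδ₀ hv0,
            hσν hw0]
          lia))
        rw [← hh] at hge
        have h1 := hge.resolve_left ((map_ne_zero _).2 hhw)
        rw [hcompat _ hhw] at h1
        exact Or.inr (by by_contra hcon; nlinarith)
      have := hmem.resolve_left hv0
      lia
    · obtain ⟨v, hv0, hv⟩ := hE.surj (d + νE v₀)
      have hmem : v ∈ {x : E | x = 0 ∨ d + νE v₀ ≤ νE x} := Or.inr hv.ge
      rw [← hdual0] at hmem
      by_contra hcon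
      have hδv := mul_ne_zero hδ₀ hv0
      have h1 := hmem (σ (δ₀ * v)⁻¹) (Or.inr (by
        rw [hσν (inv_ne_zero hδv), hE.val_inv hδv, hE.map_mul _ _ hδ₀ hv0]
        lia))
      have h4 : h v (σ (δ₀ * v)⁻¹) = 2 * 2 := by
        rw [hh, hσ2, mul_inv_cancel₀ hδv, ← map_one (algebraMap F E), Algebra.trace_algebraMap,
          hdim]
        norm_num
      rw [h4] at h1
      have h3 := h1.resolve_left (mul_ne_zero hodd.1 hodd.1)
      rw [hF.map_mul _ _ hodd.1 hodd.1, hodd.2] at h3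
      lia
  have hνx : ∀ {v : E}, v ≠ 0 → νE (β * (δ₀ * v * σ v)) =
      1 - d - n + 2 * (νE v - νE v₀) := fun {v} hv => by
    rw [hνδ hv₀] at hδv₀
    rw [hE.map_mul _ _ hβ0 (hδne hv), hνδ hv]
    lia
  have heEF : eEF = 2 := by
    obtain ⟨a, ha0, ha⟩ := hE.surj 0
    obtain ⟨b, hb0, hb⟩ := hE.surj 1
    have h1 := (htrace a ha0).2
    have h3 := (htrace b hb0).2
    rw [hνx ha0, ha] at h1
    rw [hνx hb0, hb] at h3
    have hdvd : eEF ∣ 2 := ⟨νF (h b (β * b)) - νF (h a (β * a)), by rw [mul_sub, h1, h3]; ring⟩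
    have hle := Int.le_of_dvd (by norm_num) hdvd
    have hne : eEF ≠ 1 := fun h1 =>
      hbiq.ramificationIndex_ne_one hF hE hodd hσne (by simpa [h1] using hcompat)
    lia
  have hmain : ∀ v : E, v ≠ 0 →
      2 * νF (h v (β * v)) = 1 - d - n + 2 * (νE v - νE v₀) := fun v hv => by
    rw [← hνx hv, ← (htrace v hv).2, heEF]
  have hoddnd : Odd (n + d) := by
    have := hmain v₀ hv₀
    rw [Int.odd_iff]
    lia
  refine ⟨hδv₀, hoddnd, fun v hv => ⟨(htrace v hv).1, ?_⟩, fun v hv s => ?_⟩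
  · have h1 := (htrace v hv).2
    rw [hν₀ _ (hx0 hv) (hσx v), hee, mul_assoc] at h1
    exact mul_left_cancel₀ he'.ne' h1
  · have h1 := hmain v hv
    rw [hΛ, hΛ]
    simp only [Set.mem_ofPred_eq, hv, false_or, not_le]
    rw [Int.odd_iff] at hoddnd
    lia
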